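/- arXiv:1701.07350 — 5 statements merged into one kernel-verified Lean document; each statement's English description precedes it below -/
import Mathlib

section
/- Let W be a real Banach space and h : W × ℝ → ℝ a continuous function. Suppose there is a continuous function τ : W → ℝ such that, for every w ∈ W, the function t ↦ h(w,t) is strictly increasing on (−∞, τ(w)] and strictly decreasing on [τ(w), ∞), and h(w,t) → −∞ as |t| → ∞, locally uniformly in w. Then the map G : W × ℝ → W × ℝ, G(w,t) = (w, h(w,t)), is a global fold: there exist homeomorphisms ζ and ξ of W × ℝ such that ξ(G(ζ⁻¹(w,s))) = (w, −|s|) for all (w,s) ∈ W × ℝ. -/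
theorem fiber_homeo {W : Type*} [TopologicalSpace W] (f : W × ℝ → ℝ) (hf : Continuous f)
    (hm : ∀ w, StrictMono (fun t => f (w, t)))
    (hs : ∀ w, Function.Surjective (fun t => f (w, t))) :
    ∃ e : (W × ℝ) ≃ₜ (W × ℝ), ∀ p, e p = (p.1, f p) := by
  choose g hg using hs
  have hg' : ∀ w s, f (w, g w s) = s := hg
  refine ⟨{ toFun := fun p => (p.1, f p)
            invFun := fun p => (p.1, g p.1 p.2)
            left_inv := ?_
            right_inv := ?_
            continuous_toFun := by fun_prop
            continuous_invFun := ?_ }, fun p => rfl⟩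
  · rintro ⟨w, t⟩
    exact Prod.ext rfl ((hm w).injective (hg w _))
  · rintro ⟨w, t⟩
    exact Prod.ext rfl (hg w _)
  · refine continuous_fst.prodMk ?_
    rw [continuous_iff_continuousAt]
    rintro ⟨w, s⟩
    refine tendsto_order.2 ⟨fun a ha => ?_, fun b hb => ?_⟩
    · have h1 : f (w, a) < s := by
        have := hm w ha
        simpa [hg'] using this
      have h2 : ∀ᶠ p : W × ℝ in nhds (w, s), f (p.1, a) < p.2 :=
        (isOpen_lt (by fun_prop : Continuous fun p : W × ℝ => f (p.1, a))
          continuous_snd).mem_nhds h1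
      filter_upwards [h2] with p hp
      refine (hm p.1).lt_iff_lt.1 ?_
      simpa [hg'] using hp
    · have h1 : s < f (w, b) := by
        have := hm w hb
        simpa [hg'] using this
      have h2 : ∀ᶠ p : W × ℝ in nhds (w, s), p.2 < f (p.1, b) :=
        (isOpen_lt continuous_snd
          (by fun_prop : Continuous fun p : W × ℝ => f (p.1, b))).mem_nhds h1
      filter_upwards [h2] with p hp
      refine (hm p.1).lt_iff_lt.1 ?_
      simpa [hg'] using hp

theorem stmt1 {W : Type*} [NormedAddCommGroup W] [NormedSpace ℝ W] [CompleteSpace W]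
    (h : W × ℝ → ℝ) (hh : Continuous h)
    (τ : W → ℝ) (hτ : Continuous τ)
    -- for every `w`, `t ↦ h (w, t)` is strictly increasing on `(-∞, τ w]`
    (hmono : ∀ w : W, StrictMonoOn (fun t => h (w, t)) (Set.Iic (τ w)))
    -- and strictly decreasing on `[τ w, ∞)`
    (hanti : ∀ w : W, StrictAntiOn (fun t => h (w, t)) (Set.Ici (τ w)))
    -- `h (w, t) → -∞` as `|t| → ∞`, locally uniformly in `w`
    (hlim : ∀ w₀ : W, Filter.Tendsto h
      ((nhds w₀) ×ˢ (Filter.comap (fun t : ℝ => |t|) Filter.atTop)) Filter.atBot) :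
    ∃ (ζ ξ : (W × ℝ) ≃ₜ (W × ℝ)),
      ∀ (w : W) (s : ℝ),
        ξ ((fun p : W × ℝ => (p.1, h p)) (ζ.symm (w, s))) = (w, -|s|) := by
  have hl : ∀ w (l : Filter ℝ), Filter.Tendsto (fun t : ℝ => |t|) l Filter.atTop →
      Filter.Tendsto (fun t => h (w, t)) l Filter.atBot := fun w l hl =>
    (hlim w).comp (Filter.Tendsto.prodMk tendsto_const_nhds (Filter.tendsto_comap_iff.2 hl))
  have key := fiber_homeo
    (fun p : W × ℝ => h (p.1, min p.2 (τ p.1)) - h (p.1, max p.2 (τ p.1))) (by fun_prop) ?_ ?_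
  · obtain ⟨ζ, hζ⟩ := key
    obtain ⟨ξ, hξ⟩ := fiber_homeo (fun p : W × ℝ => p.2 - h (p.1, τ p.1)) (by fun_prop)
      (fun w a b hab => by simpa using hab)
      (fun w y => ⟨y + h (w, τ w), by simp⟩)
    refine ⟨ζ, ξ, fun w s => ?_⟩
    obtain ⟨⟨w', t⟩, hp⟩ : ∃ p, p = ζ.symm (w, s) := ⟨_, rfl⟩
    have h1 : ζ (w', t) = (w, s) := by rw [hp]; simp
    rw [hζ] at h1
    rw [← hp, hξ]
    obtain ⟨rfl, h2⟩ := Prod.ext_iff.1 h1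
    simp only at h2
    refine Prod.ext rfl ?_
    simp only
    rw [← h2]
    rcases le_total t (τ w') with ht | ht
    · rw [min_eq_left ht, max_eq_right ht]
      have := (hmono w').monotoneOn ht (Set.mem_Iic.2 le_rfl) ht
      rw [abs_of_nonpos (by linarith)]; ring
    · rw [min_eq_right ht, max_eq_left ht]
      have := (hanti w').antitoneOn (Set.mem_Ici.2 le_rfl) ht ht
      rw [abs_of_nonneg (by linarith)]; ring
  · intro w a b hab
    simp only
    have m1 : h (w, min a (τ w)) ≤ h (w, min b (τ w)) :=
      (hmono w).monotoneOn (Set.mem_Iic.2 (min_le_right _ _)) (Set.mem_Iic.2 (min_le_right _ _))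
        (min_le_min_right _ hab.le)
    have m2 : h (w, max b (τ w)) ≤ h (w, max a (τ w)) :=
      (hanti w).antitoneOn (Set.mem_Ici.2 (le_max_right _ _)) (Set.mem_Ici.2 (le_max_right _ _))
        (max_le_max_right _ hab.le)
    rcases lt_or_ge a (τ w) with ha | ha
    · have : h (w, min a (τ w)) < h (w, min b (τ w)) :=
        hmono w (Set.mem_Iic.2 (min_le_right _ _)) (Set.mem_Iic.2 (min_le_right _ _))
          (by rw [min_eq_left ha.le]; exact lt_min hab ha)
      linarith
    · have : h (w, max b (τ w)) < h (w, max a (τ w)) :=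
        hanti w (Set.mem_Ici.2 (le_max_right _ _)) (Set.mem_Ici.2 (le_max_right _ _))
          (by rw [max_eq_left ha]; exact lt_max_of_lt_left hab)
      linarith
  · intro w
    refine Continuous.surjective (by fun_prop) ?_ ?_
    · have h1 := Filter.tendsto_atTop_add_const_left _ (h (w, τ w))
        (Filter.tendsto_neg_atBot_atTop.comp (hl w _ Filter.tendsto_abs_atTop_atTop))
      refine h1.congr' ?_
      filter_upwards [Filter.eventually_ge_atTop (τ w)] with t ht
      simp only [Function.comp, min_eq_right ht, max_eq_left ht]; ring
    · have h1 := Filter.tendsto_atBot_add_const_left _ (-h (w, τ w))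
        (hl w _ Filter.tendsto_abs_atBot_atTop)
      refine h1.congr' ?_
      filter_upwards [Filter.eventually_le_atBot (τ w)] with t ht
      simp only [min_eq_left ht, max_eq_right ht]; ring
end

section
/- Let X and Y be real Banach spaces, j : X → Y an injective continuous linear map, φ ∈ X nonzero, and W_X ⊆ X, W_Y ⊆ Y closed subspaces such that X = W_X ⊕ ℝφ and Y = W_Y ⊕ ℝ j(φ) are topological direct sums; let Π : Y → W_Y be the continuous projection with kernel ℝ j(φ). Let T : X → Y be a bounded linear operator with Π(Tφ) = 0, let P : X → Y be a continuous map, and set F = T − P. Assume (HLS): there exists γ ∈ ℝ such that the linear map S : W_X → W_Y, S(w) = Π(T w − γ j(w)), is a continuous linear isomorphism, and the map u ↦ Π(P(u) − γ j(u)) from X to W_Y is Lipschitz with a constant L satisfying L·‖S⁻¹‖ < 1. Then the map Ψ : X → Y defined by Ψ(w + tφ) = Π(F(w + tφ)) + t j(φ) (for w ∈ W_X, t ∈ ℝ) is a bijection, both Ψ and Ψ⁻¹ are Lipschitz, and, writing Φ = Ψ⁻¹, there is a continuous function h : W_Y × ℝ → ℝ such that F(Φ(z + t j(φ))) = z + h(z,t)·j(φ)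 for all z ∈ W_Y, t ∈ ℝ. -/
open scoped NNReal

theorem stmt2
    {X Y : Type*} [NormedAddCommGroup X] [NormedSpace ℝ X] [CompleteSpace X]
    [NormedAddCommGroup Y] [NormedSpace ℝ Y] [CompleteSpace Y]
    (j : X →L[ℝ] Y) (hj : Function.Injective j)
    (φ : X) (hφ : φ ≠ 0)
    (WX : Submodule ℝ X) (hWX : IsClosed (WX : Set X))
    (WY : Submodule ℝ Y) (hWY : IsClosed (WY : Set Y))
    -- the topological direct sum `X = W_X ⊕ ℝφ`, via the continuous projections
    -- `PX : X → W_X` and the coordinate `τ : X → ℝ` along `φ`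
    (PX : X →L[ℝ] X) (τ : X →L[ℝ] ℝ)
    (hPXmem : ∀ x : X, PX x ∈ WX) (hPXid : ∀ w ∈ WX, PX w = w)
    (hτW : ∀ w ∈ WX, τ w = 0) (hτφ : τ φ = 1) (hPXφ : PX φ = 0)
    (hXdec : ∀ x : X, x = PX x + τ x • φ)
    -- the topological direct sum `Y = W_Y ⊕ ℝ j(φ)`, via the continuous projection
    -- `PY : Y → W_Y` with kernel `ℝ j(φ)` and the coordinate `σ : Y → ℝ` along `j φ`
    (PY : Y →L[ℝ] Y) (σ : Y →L[ℝ] ℝ)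
    (hPYmem : ∀ y : Y, PY y ∈ WY) (hPYid : ∀ z ∈ WY, PY z = z)
    (hσW : ∀ z ∈ WY, σ z = 0) (hσjφ : σ (j φ) = 1) (hPYjφ : PY (j φ) = 0)
    (hYdec : ∀ y : Y, y = PY y + σ y • j φ)
    -- the bounded linear operator `T` with `Π (T φ) = 0`
    (T : X →L[ℝ] Y) (hT : PY (T φ) = 0)
    -- the continuous map `P` and `F = T - P`
    (P : X → Y) (hP : Continuous P)
    (F : X → Y) (hF : ∀ u : X, F u = T u - P u)
    -- (HLS): `S : W_X → W_Y`, `S w = Π (T w - γ j w)`, is a continuous linear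
    -- isomorphism and `u ↦ Π (P u - γ j u)` is Lipschitz with `L ‖S⁻¹‖ < 1`
    (γ : ℝ) (S : WX ≃L[ℝ] WY)
    (hS : ∀ w : WX, (S w : Y) = PY (T (w : X) - γ • j (w : X)))
    (L : ℝ≥0)
    (hLip : LipschitzWith L (fun u : X => PY (P u - γ • j u)))
    (hLS : (L : ℝ) * ‖(S.symm : WY →L[ℝ] WX)‖ < 1)
    -- the map `Ψ (w + tφ) = Π (F (w + tφ)) + t j(φ)`
    (Ψ : X → Y) (hΨ : ∀ x : X, Ψ x = PY (F x) + τ x • j φ) :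
    Function.Bijective Ψ ∧
    (∃ KΨ : ℝ≥0, LipschitzWith KΨ Ψ) ∧
    ∃ (Φ : Y → X) (KΦ : ℝ≥0) (h : WY × ℝ → ℝ),
      (∀ x : X, Φ (Ψ x) = x) ∧ (∀ y : Y, Ψ (Φ y) = y) ∧
      LipschitzWith KΦ Φ ∧ Continuous h ∧
      ∀ (z : WY) (t : ℝ), F (Φ ((z : Y) + t • j φ)) = (z : Y) + h (z, t) • j φ := by
  classical
  have hcW : CompleteSpace WX := hWX.completeSpace_coe
  -- the nonlinearity with values in WY
  obtain ⟨N, hN⟩ : ∃ N : X → WY, ∀ u, (N u : Y) = PY (P u - γ • j u) :=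
    ⟨fun u => ⟨_, hPYmem (P u - γ • j u)⟩, fun u => rfl⟩
  obtain ⟨p, hp⟩ : ∃ p : X → WX, ∀ u, (p u : X) = PX u :=
    ⟨fun u => ⟨_, hPXmem u⟩, fun u => rfl⟩
  have hNL : ∀ u v, ‖N u - N v‖ ≤ L * ‖u - v‖ := by
    intro u v
    have h1 := hLip.dist_le_mul u v
    rw [dist_eq_norm, dist_eq_norm] at h1
    rw [Submodule.coe_norm, Submodule.coe_sub, hN, hN]
    exact h1
  have hPF : ∀ x, PY (F x) = (S (p x) : Y) - N x := by
    intro x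
    have h1 : PY (T x) = PY (T (PX x)) := by
      conv_lhs => rw [hXdec x]
      simp [hT]
    have h2 : PY (j x) = PY (j (PX x)) := by
      conv_lhs => rw [hXdec x]
      simp [hPYjφ]
    rw [hF, hS, hN, hp]
    simp only [map_sub, map_smul, h1, h2]
    abel
  have hPP : ∀ y, PY (PY y) = PY y := fun y => hPYid _ (hPYmem y)
  have hPΨ : ∀ x, PY (Ψ x) = PY (F x) := by
    intro x
    rw [hΨ]
    simp [hPP, hPYjφ]
  have hσΨ : ∀ x, σ (Ψ x) = τ x := by
    intro x
    rw [hΨ]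
    simp [hσW _ (hPYmem (F x)), hσjφ]
  obtain ⟨s, hs⟩ : ∃ s : ℝ, s = ‖(S.symm : WY →L[ℝ] WX)‖ := ⟨_, rfl⟩
  have hs0 : 0 ≤ s := by rw [hs]; positivity
  have hSs : ∀ z : WY, ‖S.symm z‖ ≤ s * ‖z‖ := by
    intro z
    rw [hs]
    exact (S.symm : WY →L[ℝ] WX).le_opNorm z
  rw [← hs] at hLS
  have hd : 0 < 1 - L * s := by linarith
  have hL0 : (0:ℝ) ≤ L := L.2
  -- surjectivity
  have hsurj : Function.Surjective Ψ := by
    intro y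
    obtain ⟨z, hz⟩ : ∃ z : WY, (z : Y) = PY y := ⟨⟨_, hPYmem y⟩, rfl⟩
    let f : WX → WX := fun w => S.symm (z + N ((w : X) + σ y • φ))
    have hf : ContractingWith (Real.toNNReal (L * s)) f := by
      refine ⟨by rw [Real.toNNReal_lt_one]; exact hLS, ?_⟩
      refine LipschitzWith.of_dist_le_mul fun a b => ?_
      rw [Real.coe_toNNReal _ (mul_nonneg hL0 hs0), dist_eq_norm, dist_eq_norm]
      have e : f a - f b
          = S.symm (N ((a : X) + σ y • φ) - N ((b : X) + σ y • φ)) := by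
        simp only [f, map_add, map_sub]
        abel
      rw [e]
      have h1 := hSs (N ((a : X) + σ y • φ) - N ((b : X) + σ y • φ))
      have h2 := hNL ((a : X) + σ y • φ) ((b : X) + σ y • φ)
      rw [add_sub_add_right_eq_sub, ← Submodule.coe_sub, ← Submodule.coe_norm] at h2
      calc _ ≤ _ := h1
        _ ≤ s * (L * ‖a - b‖) := by gcongr
        _ = _ := by ring
    obtain ⟨w, hw⟩ : ∃ w, f w = w := ⟨_, hf.fixedPoint_isFixedPt⟩
    refine ⟨(w : X) + σ y • φ, ?_⟩
    have hpw : p ((w : X) + σ y • φ) = w := by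
      apply Subtype.ext
      rw [hp]
      simp [hPXφ, hPXid _ w.2]
    have hSw : S w = z + N ((w : X) + σ y • φ) := by
      conv_lhs => rw [← hw]
      simp [f]
    rw [hΨ, hPF, hpw, hSw]
    conv_rhs => rw [hYdec y]
    simp [hτW _ w.2, hτφ, hz]
  -- lower bound
  obtain ⟨K, hK0, hK⟩ : ∃ K : ℝ, 0 ≤ K ∧ ∀ x x', ‖x - x'‖ ≤ K * ‖Ψ x - Ψ x'‖ := by
    refine ⟨(s * ‖PY‖ + L * s * (‖σ‖ * ‖φ‖)) / (1 - L * s) + ‖σ‖ * ‖φ‖, by positivity, ?_⟩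
    intro x x'
    have ht : |τ x - τ x'| ≤ ‖σ‖ * ‖Ψ x - Ψ x'‖ := by
      rw [← hσΨ, ← hσΨ, ← map_sub]
      exact σ.le_opNorm _
    have hx : ‖x - x'‖ ≤ ‖p x - p x'‖ + |τ x - τ x'| * ‖φ‖ := by
      have e : x - x' = ((p x - p x' : WX) : X) + (τ x - τ x') • φ := by
        rw [Submodule.coe_sub, hp, hp, sub_smul]
        conv_lhs => rw [hXdec x, hXdec x']
        abel
      calc ‖x - x'‖ = ‖((p x - p x' : WX) : X) + (τ x - τ x') • φ‖ := by rw [← e]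
        _ ≤ _ := norm_add_le _ _
        _ = _ := by rw [norm_smul, Real.norm_eq_abs, ← Submodule.coe_norm]
    obtain ⟨z, hz⟩ : ∃ z : WY, (z : Y) = PY (Ψ x - Ψ x') := ⟨⟨_, hPYmem _⟩, rfl⟩
    have hzn : ‖z‖ ≤ ‖PY‖ * ‖Ψ x - Ψ x'‖ := by
      rw [Submodule.coe_norm, hz]
      exact PY.le_opNorm _
    have e : p x - p x' = S.symm (z + (N x - N x')) := by
      rw [ContinuousLinearEquiv.eq_symm_apply]
      apply Subtype.ext
      simp only [map_sub, Submodule.coe_add, Submodule.coe_sub, hz, hPΨ, hPF]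
      abel
    have hw : ‖p x - p x'‖ ≤ s * (‖PY‖ * ‖Ψ x - Ψ x'‖ + L * ‖x - x'‖) := by
      rw [e]
      refine (hSs _).trans ?_
      gcongr
      exact (norm_add_le _ _).trans (add_le_add hzn (hNL x x'))
    have ht' : |τ x - τ x'| * ‖φ‖ ≤ ‖σ‖ * ‖φ‖ * ‖Ψ x - Ψ x'‖ := by
      calc _ ≤ ‖σ‖ * ‖Ψ x - Ψ x'‖ * ‖φ‖ := by gcongr
        _ = _ := by ring
    have hw2 : ‖p x - p x'‖ ≤ (s * ‖PY‖ + L * s * (‖σ‖ * ‖φ‖)) / (1 - L * s) * ‖Ψ x - Ψ x'‖ := by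
      rw [div_mul_eq_mul_div, le_div_iff₀ hd]
      have h3 : s * L * ‖x - x'‖
          ≤ s * L * (‖p x - p x'‖ + ‖σ‖ * ‖φ‖ * ‖Ψ x - Ψ x'‖) := by
        gcongr
        linarith
      nlinarith
    rw [add_mul]
    linarith
  have hinj : Function.Injective Ψ := by
    intro x x' h
    have := hK x x'
    rw [h, sub_self, norm_zero, mul_zero] at this
    exact sub_eq_zero.1 (norm_le_zero_iff.1 this)
  obtain ⟨Φ, hΦ⟩ := hsurj.hasRightInverse
  have hΦL : LipschitzWith K.toNNReal Φ := by
    refine LipschitzWith.of_dist_le_mul fun a b => ?_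
    rw [Real.coe_toNNReal _ hK0, dist_eq_norm, dist_eq_norm]
    have := hK (Φ a) (Φ b)
    rwa [hΦ, hΦ] at this
  have hFc : Continuous F := by
    have : F = fun u => T u - P u := funext hF
    rw [this]
    fun_prop
  refine ⟨⟨hinj, hsurj⟩, ?_, Φ, K.toNNReal,
    fun q => σ (F (Φ ((q.1 : Y) + q.2 • j φ))), fun x => hinj (hΦ _), hΦ, hΦL, ?_, ?_⟩
  · have e : Ψ = fun x => (PY.comp (T - γ • j) + τ.smulRight (j φ)) x
        - PY (P x - γ • j x) := by
      funext x
      rw [hΨ, hF]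
      simp
      abel
    rw [e]
    exact ⟨_, (ContinuousLinearMap.lipschitz _).sub hLip⟩
  · have := hΦL.continuous
    fun_prop
  · intro z t
    have h1 := hPΨ (Φ ((z : Y) + t • j φ))
    rw [hΦ] at h1
    have h2 : PY ((z : Y) + t • j φ) = z := by
      simp [hPYjφ, hPYid _ z.2]
    conv_lhs => rw [hYdec (F (Φ ((z : Y) + t • j φ))), ← h1, h2]
end

section
/- Let X and Y be real Banach spaces, j : X → Y an injective continuous linear map, φ ∈ X nonzero, and W_X ⊆ X, W_Y ⊆ Y closed subspaces such that X = W_X ⊕ ℝφ and Y = W_Y ⊕ ℝ j(φ) are topological direct sums; let Π : Y → W_Y be the continuous projection with kernel ℝ j(φ). Let T : X → Y be a bounded linear operator with Π(Tφ) = 0, let P : X → Y be a continuous map, and set F = T − P. Assume (HLS): there exists γ ∈ ℝ such that the linear map S : W_X → W_Y, S(w) = Π(T w − γ j(w)), is a continuous linear isomorphism, and the map u ↦ Π(P(u) − γ j(u)) from X to W_Y is Lipschitz with a constant L satisfying L·‖S⁻¹‖ < 1. Assume further that there are λ_p ∈ ℝ and a continuous linear functional φ* : Y → ℝ such that φ*(j(w))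 = 0 for all w ∈ W_X, φ*(j(φ)) = 1, and φ*(T u) = λ_p · φ*(j(u)) for all u ∈ X, and assume (HPR): there exist λ_−, λ_+, c_−, c_+ ∈ ℝ with λ_− < λ_p < λ_+ such that, for all u ∈ X, φ*(P(u)) ≥ λ_− · φ*(j(u)) + c_− and φ*(P(u)) ≥ λ_+ · φ*(j(u)) + c_+. Then F = T − P : X → Y is proper. -/
open scoped NNReal

theorem stmt4
    {X Y : Type*} [NormedAddCommGroup X] [NormedSpace ℝ X] [CompleteSpace X]
    [NormedAddCommGroup Y] [NormedSpace ℝ Y] [CompleteSpace Y]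
    (j : X →L[ℝ] Y) (hj : Function.Injective j)
    (φ : X) (hφ : φ ≠ 0)
    (WX : Submodule ℝ X) (hWX : IsClosed (WX : Set X))
    (WY : Submodule ℝ Y) (hWY : IsClosed (WY : Set Y))
    -- the topological direct sum `X = W_X ⊕ ℝφ`
    (PX : X →L[ℝ] X) (τ : X →L[ℝ] ℝ)
    (hPXmem : ∀ x : X, PX x ∈ WX) (hPXid : ∀ w ∈ WX, PX w = w)
    (hτW : ∀ w ∈ WX, τ w = 0) (hτφ : τ φ = 1) (hPXφ : PX φ = 0)
    (hXdec : ∀ x : X, x = PX x + τ x • φ)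
    -- the topological direct sum `Y = W_Y ⊕ ℝ j(φ)` with projection `PY` onto `W_Y`
    (PY : Y →L[ℝ] Y) (σ : Y →L[ℝ] ℝ)
    (hPYmem : ∀ y : Y, PY y ∈ WY) (hPYid : ∀ z ∈ WY, PY z = z)
    (hσW : ∀ z ∈ WY, σ z = 0) (hσjφ : σ (j φ) = 1) (hPYjφ : PY (j φ) = 0)
    (hYdec : ∀ y : Y, y = PY y + σ y • j φ)
    -- the bounded linear operator `T` with `Π (T φ) = 0`
    (T : X →L[ℝ] Y) (hT : PY (T φ) = 0)
    -- the continuous map `P` and `F = T - P`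
    (P : X → Y) (hP : Continuous P)
    (F : X → Y) (hF : ∀ u : X, F u = T u - P u)
    -- (HLS)
    (γ : ℝ) (S : WX ≃L[ℝ] WY)
    (hS : ∀ w : WX, (S w : Y) = PY (T (w : X) - γ • j (w : X)))
    (L : ℝ≥0)
    (hLip : LipschitzWith L (fun u : X => PY (P u - γ • j u)))
    (hLS : (L : ℝ) * ‖(S.symm : WY →L[ℝ] WX)‖ < 1)
    -- the functional `φ*`
    (lp : ℝ) (φs : Y →L[ℝ] ℝ)
    (hφsW : ∀ w ∈ WX, φs (j w) = 0) (hφsφ : φs (j φ) = 1)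
    (hφsT : ∀ u : X, φs (T u) = lp * φs (j u))
    -- (HPR)
    (lminus lplus cminus cplus : ℝ)
    (hlm : lminus < lp) (hlp : lp < lplus)
    (hPR1 : ∀ u : X, φs (P u) ≥ lminus * φs (j u) + cminus)
    (hPR2 : ∀ u : X, φs (P u) ≥ lplus * φs (j u) + cplus) :
    -- conclusion: `F` is proper
    ∀ K : Set Y, IsCompact K → IsCompact (F ⁻¹' K) := by
  intro K hK
  have hFc : Continuous F := by
    have : F = fun u => T u - P u := funext hF
    rw [this]; fun_prop
  have hjt : ∀ u, φs (j u) = τ u := by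
    intro u
    conv_lhs => rw [hXdec u]
    simp [hφsW _ (hPXmem u), hφsφ]
  have hN : ∀ u, ((S ⟨PX u, hPXmem u⟩ : WY) : Y) = PY (F u) + PY (P u - γ • j u) := by
    intro u
    rw [hS, hF, ← map_add]
    have h1 : T u - P u + (P u - γ • j u)
        = (T (PX u) - γ • j (PX u)) + τ u • (T φ - γ • j φ) := by
      conv_lhs => rw [show T u - P u + (P u - γ • j u) = T u - γ • j u by abel, hXdec u]
      simp only [map_add, map_smul, smul_add, smul_sub]
      rw [smul_comm γ (τ u)]
      abel
    rw [h1]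
    simp [hT, hPYjφ]
  set s := ‖(S.symm : WY →L[ℝ] WX)‖ with hs
  have hs0 : 0 ≤ s := ContinuousLinearMap.opNorm_nonneg _
  have hq : 0 < 1 - (L : ℝ) * s := by linarith
  have hL0 : (0 : ℝ) ≤ L := L.2
  have key : ∀ u v, ‖u - v‖ ≤ ((s * ‖PY‖ + s * L * ‖φ‖) / (1 - L * s) + ‖φ‖) *
      dist (F u, τ u) (F v, τ v) := by
    intro u v
    set D := dist (F u, τ u) (F v, τ v) with hD
    have ha : ‖F u - F v‖ ≤ D := by
      rw [← dist_eq_norm, hD, Prod.dist_eq]; exact le_max_left _ _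
    have hb : |τ u - τ v| ≤ D := by
      rw [← Real.dist_eq, hD, Prod.dist_eq]; exact le_max_right _ _
    have hD0 : 0 ≤ D := dist_nonneg
    set w : WX := ⟨PX u, hPXmem u⟩ - ⟨PX v, hPXmem v⟩ with hw
    have hwn : ‖w‖ = ‖PX u - PX v‖ := rfl
    have hu : ‖u - v‖ ≤ ‖w‖ + D * ‖φ‖ := by
      have : u - v = (PX u - PX v) + (τ u - τ v) • φ := by
        conv_lhs => rw [hXdec u, hXdec v]
        rw [sub_smul]; abel
      rw [hwn]
      conv_lhs => rw [this]
      refine (norm_add_le _ _).trans ?_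
      rw [norm_smul, Real.norm_eq_abs]
      gcongr
    have h1 : ‖w‖ ≤ s * ‖S w‖ := by
      have := (S.symm : WY →L[ℝ] WX).le_opNorm (S w)
      simpa using this
    have h2 : ‖S w‖ ≤ ‖PY‖ * D + L * ‖u - v‖ := by
      have e : ((S w : WY) : Y) = PY (F u - F v) +
          (PY (P u - γ • j u) - PY (P v - γ • j v)) := by
        rw [hw, map_sub, Submodule.coe_sub, hN, hN, map_sub PY (F u)]
        abel
      rw [Submodule.coe_norm, e]
      refine (norm_add_le _ _).trans (add_le_add ?_ ?_)
      · exact (PY.le_opNorm _).trans (by gcongr)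
      · have := hLip.dist_le_mul u v
        simpa only [dist_eq_norm] using this
    have h3 : ‖w‖ * (1 - L * s) ≤ (s * ‖PY‖ + s * L * ‖φ‖) * D := by
      have h4 : s * ‖S w‖ ≤ s * (‖PY‖ * D + L * (‖w‖ + D * ‖φ‖)) := by
        gcongr
        exact h2.trans (by gcongr)
      linarith
    have h5 : ‖w‖ ≤ (s * ‖PY‖ + s * L * ‖φ‖) / (1 - L * s) * D := by
      rw [div_mul_eq_mul_div, le_div_iff₀ hq]; exact h3
    linarith
  have hC0 : 0 ≤ (s * ‖PY‖ + s * L * ‖φ‖) / (1 - L * s) + ‖φ‖ := by positivity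
  generalize (s * ‖PY‖ + s * L * ‖φ‖) / (1 - L * s) + ‖φ‖ = C at key hC0
  -- bound on τ
  obtain ⟨m, hm⟩ := (hK.image φs.continuous).bddBelow
  have hτb : ∀ u ∈ F ⁻¹' K, τ u ∈ Set.Icc ((m + cminus) / (lp - lminus))
      ((-m - cplus) / (lplus - lp)) := by
    intro u hu
    have h := hm ⟨F u, hu, rfl⟩
    rw [hF, map_sub, hφsT, hjt] at h
    have h1 := hPR1 u
    have h2 := hPR2 u
    rw [hjt] at h1 h2
    constructor
    · rw [div_le_iff₀ (by linarith)]; linarith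
    · rw [le_div_iff₀ (by linarith)]; linarith
  have hc := hK.prod (isCompact_Icc (a := (m + cminus) / (lp - lminus))
    (b := (-m - cplus) / (lplus - lp)))
  apply IsSeqCompact.isCompact
  intro x hx
  obtain ⟨y, -, ψ, hψ, hlim⟩ := hc.isSeqCompact (x := fun n => (F (x n), τ (x n)))
    (fun n => ⟨hx n, hτb _ (hx n)⟩)
  have hcau : CauchySeq (x ∘ ψ) := by
    rw [Metric.cauchySeq_iff]
    intro ε hε
    obtain ⟨N, hN'⟩ := Metric.cauchySeq_iff.1 hlim.cauchySeq (ε / (C + 1)) (by positivity)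
    refine ⟨N, fun a ha b hb => ?_⟩
    have h1 := hN' a ha b hb
    rw [lt_div_iff₀ (by positivity)] at h1
    have h2 := key (x (ψ a)) (x (ψ b))
    rw [dist_eq_norm]
    simp only [Function.comp_apply] at h1 ⊢
    have h3 : 0 ≤ dist (F (x (ψ a)), τ (x (ψ a))) (F (x (ψ b)), τ (x (ψ b))) := dist_nonneg
    linarith
  obtain ⟨z, hz⟩ := cauchySeq_tendsto_of_complete hcau
  exact ⟨z, (hK.isClosed.preimage hFc).mem_of_tendsto hz
    (Filter.Eventually.of_forall fun n => hx _), ψ, hψ, hz⟩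
end

section
/- Let W be a Hausdorff topological space and h : W × ℝ → ℝ a continuous function. Suppose there exist real constants a > 0 > b and c, c' ∈ ℝ such that h(z,t) ≤ a·t + c and h(z,t) ≤ b·t + c' for all (z,t) ∈ W × ℝ. Then the map G : W × ℝ → W × ℝ, G(z,t) = (z, h(z,t)), is proper. -/
theorem stmt5 {W : Type*} [TopologicalSpace W] [T2Space W]
    (h : W × ℝ → ℝ) (hh : Continuous h)
    (a b c c' : ℝ) (ha : 0 < a) (hb : b < 0)
    (hub1 : ∀ (z : W) (t : ℝ), h (z, t) ≤ a * t + c)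
    (hub2 : ∀ (z : W) (t : ℝ), h (z, t) ≤ b * t + c') :
    ∀ K : Set (W × ℝ), IsCompact K →
      IsCompact ((fun p : W × ℝ => (p.1, h p)) ⁻¹' K) := by
  intro K hK
  obtain ⟨m, hm⟩ := (hK.image continuous_snd).bddBelow
  have hcl : IsClosed ((fun p : W × ℝ => (p.1, h p)) ⁻¹' K) :=
    hK.isClosed.preimage (continuous_fst.prodMk hh)
  refine IsCompact.of_isClosed_subset
    ((hK.image continuous_fst).prod (isCompact_Icc (a := (m - c) / a) (b := (m - c') / b)))
    hcl ?_
  rintro ⟨z, t⟩ hp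
  have hp' : (z, h (z, t)) ∈ K := hp
  have h1 : m ≤ h (z, t) := hm ⟨_, hp', rfl⟩
  have h2 := hub1 z t
  have h3 := hub2 z t
  refine ⟨⟨_, hp', rfl⟩, ?_, ?_⟩
  · show (m - c) / a ≤ t
    rw [div_le_iff₀ ha]
    linarith
  · show t ≤ (m - c') / b
    rw [le_div_iff_of_neg hb]
    linarith
end

section
/- Let H be a real Hilbert space, a ≤ b real numbers, and P : H → H a Fréchet differentiable map such that, for every u ∈ H, the Fréchet derivative DP(u) : H → H is a bounded self-adjoint operator whose spectrum (over ℝ) is contained in the interval [a,b]. Set γ = (a+b)/2. Then for all u, v ∈ H, ‖P(u) − P(v) − γ(u − v)‖ ≤ ((b−a)/2)·‖u − v‖; that is, the map u ↦ P(u) − γu is Lipschitz with constant (b−a)/2. -/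
open scoped RealInnerProductSpace

theorem stmt6 {H : Type*} [NormedAddCommGroup H] [InnerProductSpace ℝ H]
    [CompleteSpace H]
    (a b : ℝ) (hab : a ≤ b)
    (P : H → H) (P' : H → H →L[ℝ] H)
    (hdiff : ∀ u : H, HasFDerivAt P (P' u) u)
    (hsym : ∀ (u x y : H), ⟪P' u x, y⟫ = ⟪x, P' u y⟫)
    (hspec : ∀ u : H, spectrum ℝ (P' u) ⊆ Set.Icc a b) :
    ∀ u v : H,
      ‖P u - P v - ((a + b) / 2) • (u - v)‖ ≤ ((b - a) / 2) * ‖u - v‖ := by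
  have key : ∀ u : H,
      ‖P' u - ((a + b) / 2) • ContinuousLinearMap.id ℝ H‖ ≤ (b - a) / 2 := by
    intro u
    set T : H →L[ℝ] H := P' u - ((a + b) / 2) • ContinuousLinearMap.id ℝ H with hT
    have hsa : IsSelfAdjoint T := by
      rw [ContinuousLinearMap.isSelfAdjoint_iff_isSymmetric]
      intro x y
      simp [hT, inner_sub_left, inner_sub_right, inner_smul_left, inner_smul_right, hsym]
    have h := T.spectralRadius_eq_nnnorm hsa
    have hle : spectralRadius ℝ T ≤ ENNReal.ofReal ((b - a) / 2) := by
      refine iSup₂_le fun k hk => ?_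
      have hk' : k + (a + b) / 2 ∈ spectrum ℝ (P' u) := by
        rw [spectrum.mem_iff] at hk ⊢
        convert hk using 2
        ext x
        simp [hT, Algebra.algebraMap_eq_smul_one, add_smul]
        abel
      have h2 := hspec u hk'
      change ‖k‖ₑ ≤ _
      rw [← ofReal_norm]
      apply ENNReal.ofReal_le_ofReal
      rw [Real.norm_eq_abs, abs_le]
      constructor <;> linarith [h2.1, h2.2]
    rw [h] at hle
    have h3 := ENNReal.toReal_mono ENNReal.ofReal_ne_top hle
    rw [ENNReal.toReal_ofReal (by linarith)] at h3
    simpa using h3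
  intro u v
  have hf : ∀ x ∈ (Set.univ : Set H), HasFDerivWithinAt (fun x => P x - ((a + b) / 2) • x)
      (P' x - ((a + b) / 2) • ContinuousLinearMap.id ℝ H) Set.univ x := fun x _ =>
    ((hdiff x).sub ((hasFDerivAt_id x).const_smul ((a + b) / 2))).hasFDerivWithinAt
  have := convex_univ.norm_image_sub_le_of_norm_hasFDerivWithin_le hf (fun x _ => key x)
    (Set.mem_univ v) (Set.mem_univ u)
  convert this using 2
  rw [smul_sub]; abel
end
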